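/- The convergent series ∑_{k=1}^∞ (H_{3k} − 8·H_{2k} + 7·H_k)·(25k − 3)/(2^k·C(3k,k)) equals 2G − 2·(π + 9)·log 2, where G is Catalan's constant. -/

import Mathlib

open scoped BigOperators

/-- The `m`-th harmonic number `H_m = ∑_{j=1}^m 1/j`. -/
noncomputable def harmonicNum (m : ℕ) : ℝ := ∑ j ∈ Finset.range m, 1 / (j + 1 : ℝ)

/-- Catalan's constant `G = ∑_{n=0}^∞ (-1)^n/(2n+1)²`. -/
noncomputable def catalanG : ℝ := ∑' n : ℕ, (-1) ^ n / (2 * n + 1 : ℝ) ^ 2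

lemma harmonicNum_succ (m : ℕ) : harmonicNum (m + 1) = harmonicNum m + 1 / (m + 1 : ℝ) := by
  simp [harmonicNum, Finset.sum_range_succ]

lemma intervalIntegrable_log_one_sub :
    IntervalIntegrable (fun x : ℝ => Real.log (1 - x)) MeasureTheory.volume 0 1 := by
  have h : IntervalIntegrable Real.log MeasureTheory.volume 0 1 :=
    intervalIntegral.intervalIntegrable_log'
  simpa using (h.comp_sub_left 1).symm

lemma integral_pow_mul_log (a : ℕ) :
    ∫ x in (0 : ℝ)..1, x ^ a * Real.log x = -1 / (a + 1 : ℝ) ^ 2 := by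
  have ha : (a + 1 : ℝ) ≠ 0 := by positivity
  have hint : IntervalIntegrable (fun x : ℝ => x ^ a * Real.log x) MeasureTheory.volume 0 1 :=
    intervalIntegral.intervalIntegrable_log'.continuousOn_mul (by fun_prop)
  have hcont : Continuous fun x : ℝ =>
      x ^ a * (x * Real.log x) / (a + 1) - x ^ (a + 1) / (a + 1) ^ 2 := by
    have := Real.continuous_mul_log
    fun_prop
  rw [intervalIntegral.integral_eq_sub_of_hasDerivAt_of_le zero_le_one hcont.continuousOn
    (fun x hx => ?_) hint]
  · simp
    ring
  · have hx0 : x ≠ 0 := hx.1.ne'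
    have h := (((hasDerivAt_pow (a + 1) x).mul (Real.hasDerivAt_log hx0)).div_const
      (a + 1 : ℝ)).sub ((hasDerivAt_pow (a + 1) x).div_const ((a + 1 : ℝ) ^ 2))
    have e : (fun x : ℝ => x ^ a * (x * Real.log x) / (a + 1) - x ^ (a + 1) / (a + 1) ^ 2) =
        fun x => x ^ (a + 1) * Real.log x / (a + 1) - x ^ (a + 1) / (a + 1 : ℝ) ^ 2 := by
      ext y; ring
    rw [e]
    refine h.congr_deriv ?_
    push_cast
    field_simp
    ring

lemma integral_pow_mul_one_sub_pow (a b : ℕ) :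
    ∫ x in (0 : ℝ)..1, x ^ a * (1 - x) ^ b =
      (a.factorial * b.factorial : ℝ) / (a + b + 1).factorial := by
  induction b generalizing a with
  | zero =>
    simp only [pow_zero, mul_one, integral_pow, add_zero, Nat.factorial_succ]
    have : (a.factorial : ℝ) ≠ 0 := by positivity
    push_cast
    field_simp
    ring
  | succ b ih =>
    have e : (fun x : ℝ => x ^ a * (1 - x) ^ (b + 1)) =
        fun x => x ^ a * (1 - x) ^ b - x ^ (a + 1) * (1 - x) ^ b := by
      ext x; ring
    rw [e, intervalIntegral.integral_sub (Continuous.intervalIntegrable (by fun_prop) _ _)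
      (Continuous.intervalIntegrable (by fun_prop) _ _), ih, ih,
      show a + 1 + b + 1 = (a + b + 1) + 1 by ring, show a + (b + 1) + 1 = (a + b + 1) + 1 by ring]
    simp only [Nat.factorial_succ (a + b + 1), Nat.factorial_succ a, Nat.factorial_succ b]
    have : ((a + b + 1).factorial : ℝ) ≠ 0 := by positivity
    push_cast
    field_simp
    ring

lemma intervalIntegrable_pow_mul_one_sub_pow_mul_log (a b : ℕ) :
    IntervalIntegrable (fun x : ℝ => x ^ a * (1 - x) ^ b * Real.log x)
      MeasureTheory.volume 0 1 :=
  intervalIntegral.intervalIntegrable_log'.continuousOn_mul (by fun_prop)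

lemma integral_pow_mul_one_sub_pow_mul_log (a b : ℕ) :
    ∫ x in (0 : ℝ)..1, x ^ a * (1 - x) ^ b * Real.log x =
      (a.factorial * b.factorial : ℝ) / (a + b + 1).factorial *
        (harmonicNum a - harmonicNum (a + b + 1)) := by
  induction b generalizing a with
  | zero =>
    simp only [pow_zero, mul_one, integral_pow_mul_log, add_zero, Nat.factorial_succ,
      harmonicNum_succ]
    have : (a.factorial : ℝ) ≠ 0 := by positivity
    push_cast
    field_simp
    ring
  | succ b ih =>
    have e : (fun x : ℝ => x ^ a * (1 - x) ^ (b + 1) * Real.log x) = fun x =>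
        x ^ a * (1 - x) ^ b * Real.log x - x ^ (a + 1) * (1 - x) ^ b * Real.log x := by
      ext x; ring
    rw [e, intervalIntegral.integral_sub (intervalIntegrable_pow_mul_one_sub_pow_mul_log a b)
      (intervalIntegrable_pow_mul_one_sub_pow_mul_log (a + 1) b), ih, ih,
      show a + 1 + b + 1 = (a + b + 1) + 1 by ring, show a + (b + 1) + 1 = (a + b + 1) + 1 by ring]
    simp only [Nat.factorial_succ (a + b + 1), Nat.factorial_succ a, Nat.factorial_succ b,
      harmonicNum_succ]
    have : ((a + b + 1).factorial : ℝ) ≠ 0 := by positivity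
    push_cast
    field_simp
    ring

lemma integral_pow_mul_one_sub_pow_mul_log_one_sub (a b : ℕ) :
    ∫ x in (0 : ℝ)..1, x ^ a * (1 - x) ^ b * Real.log (1 - x) =
      (a.factorial * b.factorial : ℝ) / (a + b + 1).factorial *
        (harmonicNum b - harmonicNum (a + b + 1)) := by
  have h := intervalIntegral.integral_comp_sub_left (a := 0) (b := 1)
    (fun x : ℝ => x ^ b * (1 - x) ^ a * Real.log x) 1
  simp only [sub_sub_cancel, sub_self, sub_zero] at h
  rw [integral_pow_mul_one_sub_pow_mul_log] at h
  simp only [mul_comm, add_comm a b] at h ⊢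
  exact h

lemma intervalIntegrable_div_one_add_sq {f : ℝ → ℝ}
    (hf : IntervalIntegrable f MeasureTheory.volume 0 1) :
    IntervalIntegrable (fun x : ℝ => f x / (1 + x ^ 2)) MeasureTheory.volume 0 1 := by
  simp only [div_eq_mul_inv]
  refine hf.mul_continuousOn (ContinuousOn.inv₀ (by fun_prop) fun x _ => ?_)
  positivity

lemma integral_log_div_one_add_sq :
    ∫ x in (0 : ℝ)..1, Real.log x / (1 + x ^ 2) = -catalanG := by
  have hlog (n : ℕ) : ∫ x in Set.Ioc (0 : ℝ) 1, x ^ (2 * n) * Real.log x =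
      -1 / (2 * n + 1 : ℝ) ^ 2 := by
    rw [← intervalIntegral.integral_of_le zero_le_one, integral_pow_mul_log]
    push_cast
    rfl
  have hint (n : ℕ) : MeasureTheory.Integrable (fun x : ℝ => (-1) ^ n * (x ^ (2 * n) * Real.log x))
      (MeasureTheory.volume.restrict (Set.Ioc 0 1)) := by
    have h : IntervalIntegrable (fun x : ℝ => x ^ (2 * n) * Real.log x)
        MeasureTheory.volume 0 1 :=
      intervalIntegral.intervalIntegrable_log'.continuousOn_mul (by fun_prop)
    exact ((intervalIntegrable_iff_integrableOn_Ioc_of_le zero_le_one).1 h).const_mul _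
  have hnorm (n : ℕ) : ∫ x in Set.Ioc (0 : ℝ) 1, ‖(-1) ^ n * (x ^ (2 * n) * Real.log x)‖ =
      1 / (2 * n + 1 : ℝ) ^ 2 := by
    have e : Set.EqOn (fun x : ℝ => ‖(-1) ^ n * (x ^ (2 * n) * Real.log x)‖)
        (fun x => -(x ^ (2 * n) * Real.log x)) (Set.Ioc 0 1) := fun x hx => by
      have h : x ^ (2 * n) * Real.log x ≤ 0 :=
        mul_nonpos_of_nonneg_of_nonpos (pow_nonneg hx.1.le _) (Real.log_nonpos hx.1.le hx.2)
      simp only [norm_mul ((-1 : ℝ) ^ n), norm_pow, norm_neg, norm_one, one_pow, one_mul,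
        Real.norm_of_nonpos h]
    rw [MeasureTheory.setIntegral_congr_fun measurableSet_Ioc e, MeasureTheory.integral_neg, hlog]
    ring
  have hsum : Summable fun n : ℕ => 1 / (2 * n + 1 : ℝ) ^ 2 := by
    have h := (Real.summable_one_div_nat_pow (p := 2)).2 one_lt_two
    have h2 := h.comp_injective (i := fun n : ℕ => 2 * n + 1) (fun a b hab => by simpa using hab)
    refine h2.congr fun n => ?_
    simp
  have key := MeasureTheory.hasSum_integral_of_summable_integral_norm hint
    (by simpa only [hnorm] using hsum)
  have e : Set.EqOn (fun x : ℝ => ∑' n : ℕ, (-1) ^ n * (x ^ (2 * n) * Real.log x))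
      (fun x => Real.log x / (1 + x ^ 2)) (Set.Ioc 0 1) := fun x hx => by
    rcases hx.2.eq_or_lt with rfl | hx1
    · simp
    have hr : ‖-x ^ 2‖ < 1 := by
      rw [norm_neg, norm_pow, Real.norm_of_nonneg hx.1.le]
      exact pow_lt_one₀ hx.1.le hx1 two_ne_zero
    have h := (hasSum_geometric_of_norm_lt_one hr).mul_right (Real.log x)
    beta_reduce
    rw [show Real.log x / (1 + x ^ 2) = (1 - -x ^ 2)⁻¹ * Real.log x by
      rw [sub_neg_eq_add, div_eq_inv_mul], ← h.tsum_eq]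
    refine tsum_congr fun n => ?_
    rw [neg_pow (x ^ 2), ← pow_mul]
    ring
  rw [MeasureTheory.setIntegral_congr_fun measurableSet_Ioc e] at key
  rw [intervalIntegral.integral_of_le zero_le_one, ← key.tsum_eq, catalanG, ← tsum_neg]
  refine tsum_congr fun n => ?_
  rw [MeasureTheory.integral_const_mul, hlog]
  ring

lemma image_one_sub_div_one_add :
    (fun x : ℝ => (1 - x) / (1 + x)) '' Set.Ioo 0 1 = Set.Ioo 0 1 := by
  have maps (x : ℝ) (hx : x ∈ Set.Ioo (0 : ℝ) 1) : (1 - x) / (1 + x) ∈ Set.Ioo (0 : ℝ) 1 := by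
    have h : 0 < 1 + x := by linarith [hx.1]
    exact ⟨div_pos (by linarith [hx.2]) h, by rw [div_lt_one h]; linarith [hx.1]⟩
  ext y
  refine ⟨fun ⟨x, hx, h⟩ => h ▸ maps x hx, fun hy => ⟨_, maps y hy, ?_⟩⟩
  have : 1 + y ≠ 0 := by linarith [hy.1]
  field_simp
  ring

lemma integral_comp_one_sub_div_one_add (f : ℝ → ℝ) :
    ∫ x in (0 : ℝ)..1, f ((1 - x) / (1 + x)) / (1 + x ^ 2) =
      ∫ x in (0 : ℝ)..1, f x / (1 + x ^ 2) := by
  have hderiv : ∀ x ∈ Set.Ioo (0 : ℝ) 1,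
      HasDerivWithinAt (fun x : ℝ => (1 - x) / (1 + x)) (-2 / (1 + x) ^ 2) (Set.Ioo 0 1) x :=
    fun x hx => by
      have h0 : 1 + x ≠ 0 := by linarith [hx.1]
      refine ((((hasDerivAt_id' x).const_sub 1).div ((hasDerivAt_id' x).const_add 1)
        h0).congr_deriv ?_).hasDerivWithinAt
      field_simp
      ring
  have hinj : Set.InjOn (fun x : ℝ => (1 - x) / (1 + x)) (Set.Ioo 0 1) := fun x hx y hy h => by
    have hx0 : 1 + x ≠ 0 := by linarith [hx.1]
    have hy0 : 1 + y ≠ 0 := by linarith [hy.1]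
    rw [div_eq_div_iff hx0 hy0] at h
    linarith
  have h := MeasureTheory.integral_image_eq_integral_abs_deriv_smul measurableSet_Ioo hderiv hinj
    fun x => f x / (1 + x ^ 2)
  rw [image_one_sub_div_one_add] at h
  simp only [intervalIntegral.integral_of_le zero_le_one (a := (0 : ℝ)),
    MeasureTheory.integral_Ioc_eq_integral_Ioo]
  rw [h]
  refine MeasureTheory.setIntegral_congr_fun measurableSet_Ioo fun x hx => ?_
  have h0 : 1 + x ≠ 0 := by linarith [hx.1]
  have h1 : 1 + x ^ 2 ≠ 0 := by positivity
  have h2 : 1 + ((1 - x) / (1 + x)) ^ 2 ≠ 0 := by positivity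
  have h3 : |-2 / (1 + x) ^ 2| = 2 / (1 + x) ^ 2 := by
    rw [neg_div, abs_neg, abs_of_nonneg (by positivity)]
  have h4 : 1 + ((1 - x) / (1 + x)) ^ 2 = 2 * (1 + x ^ 2) / (1 + x) ^ 2 := by
    field_simp
    ring
  simp only [h3, h4, smul_eq_mul]
  field_simp

lemma integral_const_div_one_add_sq (c : ℝ) :
    ∫ x in (0 : ℝ)..1, c / (1 + x ^ 2) = c * (Real.pi / 4) := by
  have h := integral_one_div_one_add_sq (a := 0) (b := 1)
  simp only [Real.arctan_one, Real.arctan_zero, sub_zero] at h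
  rw [← h, ← intervalIntegral.integral_const_mul]
  simp only [mul_one_div]

lemma intervalIntegrable_log_one_add :
    IntervalIntegrable (fun x : ℝ => Real.log (1 + x)) MeasureTheory.volume 0 1 :=
  ContinuousOn.intervalIntegrable <| ContinuousOn.log (by fun_prop) fun x hx => by
    rw [Set.uIcc_of_le zero_le_one] at hx
    linarith [hx.1]

lemma integral_log_one_add_div_one_add_sq :
    ∫ x in (0 : ℝ)..1, Real.log (1 + x) / (1 + x ^ 2) = Real.pi / 8 * Real.log 2 := by
  have h := integral_comp_one_sub_div_one_add fun x => Real.log (1 + x)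
  have e : ∫ x in (0 : ℝ)..1, Real.log (1 + (1 - x) / (1 + x)) / (1 + x ^ 2) =
      ∫ x in (0 : ℝ)..1, (Real.log 2 / (1 + x ^ 2) - Real.log (1 + x) / (1 + x ^ 2)) := by
    refine intervalIntegral.integral_congr fun x hx => ?_
    rw [Set.uIcc_of_le zero_le_one] at hx
    have h0 : 1 + x ≠ 0 := by linarith [hx.1]
    simp only [show 1 + (1 - x) / (1 + x) = 2 / (1 + x) by field_simp; ring,
      Real.log_div two_ne_zero h0]
    exact sub_div _ _ _
  rw [e, intervalIntegral.integral_sub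
    (intervalIntegrable_div_one_add_sq intervalIntegrable_const)
    (intervalIntegrable_div_one_add_sq intervalIntegrable_log_one_add),
    integral_const_div_one_add_sq] at h
  linarith

lemma integral_log_one_sub_div_one_add_sq :
    ∫ x in (0 : ℝ)..1, Real.log (1 - x) / (1 + x ^ 2) =
      Real.pi / 8 * Real.log 2 - catalanG := by
  have h := integral_comp_one_sub_div_one_add fun x => Real.log (1 - x)
  have e : ∫ x in (0 : ℝ)..1, Real.log (1 - (1 - x) / (1 + x)) / (1 + x ^ 2) =
      ∫ x in (0 : ℝ)..1, (Real.log 2 / (1 + x ^ 2) + Real.log x / (1 + x ^ 2) -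
        Real.log (1 + x) / (1 + x ^ 2)) := by
    simp only [intervalIntegral.integral_of_le zero_le_one (a := (0 : ℝ))]
    refine MeasureTheory.setIntegral_congr_fun measurableSet_Ioc fun x hx => ?_
    have h0 : 1 + x ≠ 0 := by linarith [hx.1]
    simp only [show 1 - (1 - x) / (1 + x) = 2 * x / (1 + x) by field_simp; ring,
      Real.log_div (mul_ne_zero two_ne_zero hx.1.ne') h0, Real.log_mul two_ne_zero hx.1.ne']
    ring
  have hc := intervalIntegrable_div_one_add_sq (f := fun _ => Real.log 2)
    intervalIntegrable_const
  have hl := intervalIntegrable_div_one_add_sq intervalIntegral.intervalIntegrable_log'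
  rw [← h, e, intervalIntegral.integral_sub (hc.add hl)
    (intervalIntegrable_div_one_add_sq intervalIntegrable_log_one_add),
    intervalIntegral.integral_add hc hl, integral_const_div_one_add_sq,
    integral_log_div_one_add_sq, integral_log_one_add_div_one_add_sq]
  ring

lemma hasSum_linear_mul_geometric {r : ℝ} (hr : ‖r‖ < 1) :
    HasSum (fun k : ℕ => (25 * (k + 1 : ℝ) - 3) * r ^ k) (25 / (1 - r) ^ 2 - 3 / (1 - r)) := by
  have h0 := (hasSum_choose_mul_geometric_of_norm_lt_one 0 hr).mul_left 3
  have h1 := (hasSum_choose_mul_geometric_of_norm_lt_one 1 hr).mul_left 25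
  rw [show 25 / (1 - r) ^ 2 - 3 / (1 - r) =
    25 * (1 / (1 - r) ^ (1 + 1)) - 3 * (1 / (1 - r) ^ (0 + 1)) by ring]
  refine Eq.mp (congrArg (HasSum · _) (funext fun k => ?_)) (h1.sub h0)
  simp
  ring

lemma hasSum_quadratic_mul_geometric {r : ℝ} (hr : ‖r‖ < 1) :
    HasSum (fun k : ℕ => (25 * (k + 1 : ℝ) - 3) * (k + 1) * r ^ k)
      (50 / (1 - r) ^ 3 - 28 / (1 - r) ^ 2) := by
  have h1 := (hasSum_choose_mul_geometric_of_norm_lt_one 1 hr).mul_left 28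
  have h2 := (hasSum_choose_mul_geometric_of_norm_lt_one 2 hr).mul_left 50
  rw [show 50 / (1 - r) ^ 3 - 28 / (1 - r) ^ 2 =
    50 * (1 / (1 - r) ^ (2 + 1)) - 28 * (1 / (1 - r) ^ (1 + 1)) by ring]
  refine Eq.mp (congrArg (HasSum · _) (funext fun k => ?_)) (h2.sub h1)
  rw [Nat.cast_choose_two]
  simp
  ring

/-- The logarithmic weight whose beta-type moments produce `H_{3k} - 8 H_{2k} + 7 H_{k-1}`. -/
noncomputable def logWeight (x : ℝ) : ℝ := 7 * Real.log x - 8 * Real.log (1 - x)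

lemma intervalIntegrable_logWeight :
    IntervalIntegrable logWeight MeasureTheory.volume 0 1 :=
  (intervalIntegral.intervalIntegrable_log'.const_mul 7).sub
    (intervalIntegrable_log_one_sub.const_mul 8)

/-- The integrand on `[0, 1]` representing the `k`-th summand of the series. -/
noncomputable def termIntegrand (k : ℕ) (x : ℝ) : ℝ :=
  (25 * (k + 1 : ℝ) - 3) * (x * (1 - x) ^ 2 / 2) ^ k * ((1 - x) ^ 2 / 2) *
    ((k + 1) * logWeight x + 7)

/-- The sum over `k` of `termIntegrand k`. -/
noncomputable def seriesIntegrand (x : ℝ) : ℝ :=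
  (1 - x) ^ 2 / 2 * (400 / ((2 - x) * (1 + x ^ 2)) ^ 3 - 112 / ((2 - x) * (1 + x ^ 2)) ^ 2) *
      logWeight x +
    7 * (1 - x) ^ 2 / 2 * (100 / ((2 - x) * (1 + x ^ 2)) ^ 2 - 6 / ((2 - x) * (1 + x ^ 2)))

lemma integral_termIntegrand (k : ℕ) :
    ∫ x in (0 : ℝ)..1, termIntegrand k x =
      (harmonicNum (3 * (k + 1)) - 8 * harmonicNum (2 * (k + 1)) + 7 * harmonicNum (k + 1)) *
        (25 * (k + 1 : ℝ) - 3) / (2 ^ (k + 1) * (Nat.choose (3 * (k + 1)) (k + 1) : ℝ)) := by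
  have e : termIntegrand k = fun x => (25 * (k + 1 : ℝ) - 3) / 2 ^ (k + 1) *
      ((k + 1) * (7 * (x ^ k * (1 - x) ^ (2 * (k + 1)) * Real.log x) -
        8 * (x ^ k * (1 - x) ^ (2 * (k + 1)) * Real.log (1 - x))) +
        7 * (x ^ k * (1 - x) ^ (2 * (k + 1)))) := by
    ext x
    rw [termIntegrand, logWeight, div_pow, mul_pow, ← pow_mul]
    field_simp
    ring
  have h1 := intervalIntegrable_pow_mul_one_sub_pow_mul_log k (2 * (k + 1))
  have h2 : IntervalIntegrable
      (fun x : ℝ => x ^ k * (1 - x) ^ (2 * (k + 1)) * Real.log (1 - x))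
      MeasureTheory.volume 0 1 :=
    intervalIntegrable_log_one_sub.continuousOn_mul (by fun_prop)
  have h3 : IntervalIntegrable (fun x : ℝ => x ^ k * (1 - x) ^ (2 * (k + 1)))
      MeasureTheory.volume 0 1 := Continuous.intervalIntegrable (by fun_prop) _ _
  rw [e, intervalIntegral.integral_const_mul, intervalIntegral.integral_add
    (((h1.const_mul 7).sub (h2.const_mul 8)).const_mul _) (h3.const_mul 7),
    intervalIntegral.integral_const_mul, intervalIntegral.integral_sub
    (h1.const_mul 7) (h2.const_mul 8), intervalIntegral.integral_const_mul,
    intervalIntegral.integral_const_mul, intervalIntegral.integral_const_mul,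
    integral_pow_mul_one_sub_pow, integral_pow_mul_one_sub_pow_mul_log,
    integral_pow_mul_one_sub_pow_mul_log_one_sub,
    Nat.cast_choose ℝ (show k + 1 ≤ 3 * (k + 1) by lia),
    show 3 * (k + 1) - (k + 1) = 2 * (k + 1) by lia,
    show k + 2 * (k + 1) + 1 = 3 * (k + 1) by ring, harmonicNum_succ, Nat.factorial_succ k]
  have f1 : ((3 * (k + 1)).factorial : ℝ) ≠ 0 := by positivity
  have f2 : ((2 * (k + 1)).factorial : ℝ) ≠ 0 := by positivity
  have f3 : (k.factorial : ℝ) ≠ 0 := by positivity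
  push_cast
  field_simp
  ring

lemma mul_one_sub_sq_div_two_mem {x : ℝ} (hx : x ∈ Set.Ioc (0 : ℝ) 1) :
    x * (1 - x) ^ 2 / 2 ∈ Set.Icc (0 : ℝ) (1 / 2) := by
  have h0 := hx.1.le
  have h1 : (1 - x) ^ 2 ≤ 1 := pow_le_one₀ (by linarith [hx.2]) (by linarith)
  have h2 : x * (1 - x) ^ 2 ≤ 1 := mul_le_one₀ hx.2 (by positivity) h1
  exact ⟨by positivity, by linarith⟩

lemma hasSum_termIntegrand {x : ℝ} (hx : x ∈ Set.Ioc (0 : ℝ) 1) :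
    HasSum (fun k => termIntegrand k x) (seriesIntegrand x) := by
  have ht := mul_one_sub_sq_div_two_mem hx
  have hr : ‖x * (1 - x) ^ 2 / 2‖ < 1 := by
    rw [Real.norm_of_nonneg ht.1]
    linarith [ht.2]
  have h1 := (hasSum_quadratic_mul_geometric hr).mul_right ((1 - x) ^ 2 / 2 * logWeight x)
  have h2 := (hasSum_linear_mul_geometric hr).mul_right (7 * (1 - x) ^ 2 / 2)
  have h := h1.add h2
  rw [show 1 - x * (1 - x) ^ 2 / 2 = (2 - x) * (1 + x ^ 2) / 2 by ring] at h
  have e : seriesIntegrand x = (50 / ((2 - x) * (1 + x ^ 2) / 2) ^ 3 -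
      28 / ((2 - x) * (1 + x ^ 2) / 2) ^ 2) * ((1 - x) ^ 2 / 2 * logWeight x) +
      (25 / ((2 - x) * (1 + x ^ 2) / 2) ^ 2 - 3 / ((2 - x) * (1 + x ^ 2) / 2)) *
        (7 * (1 - x) ^ 2 / 2) := by
    have : 2 - x ≠ 0 := by linarith [hx.2]
    have : 1 + x ^ 2 ≠ 0 := by positivity
    rw [seriesIntegrand]
    field_simp
    ring
  rw [e]
  refine Eq.mp (congrArg (HasSum · _) (funext fun k => ?_)) h
  rw [termIntegrand]
  ring

lemma norm_termIntegrand_le (k : ℕ) {x : ℝ} (hx : x ∈ Set.Ioc (0 : ℝ) 1) :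
    ‖termIntegrand k x‖ ≤
      (25 * (k + 1 : ℝ) - 3) * (k + 1) * (1 / 2) ^ k * (|logWeight x| + 7) := by
  have ht := mul_one_sub_sq_div_two_mem hx
  have hk : (0 : ℝ) ≤ k := k.cast_nonneg
  have hc : 0 ≤ 25 * (k + 1 : ℝ) - 3 := by linarith
  have h1 : (1 - x) ^ 2 ≤ 1 := pow_le_one₀ (by linarith [hx.2]) (by linarith [hx.1])
  have h2 : |(k + 1) * logWeight x + 7| ≤ (k + 1) * (|logWeight x| + 7) := by
    refine (abs_add_le _ _).trans ?_
    rw [abs_mul, abs_of_nonneg (by positivity : (0 : ℝ) ≤ k + 1),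
      abs_of_nonneg (by norm_num : (0 : ℝ) ≤ 7)]
    nlinarith
  rw [termIntegrand, norm_mul, norm_mul, norm_mul, norm_pow, Real.norm_of_nonneg hc,
    Real.norm_of_nonneg ht.1, Real.norm_of_nonneg (by positivity : 0 ≤ (1 - x) ^ 2 / 2),
    Real.norm_eq_abs]
  calc _ ≤ (25 * (k + 1 : ℝ) - 3) * (1 / 2) ^ k * 1 * ((k + 1) * (|logWeight x| + 7)) := by
        gcongr
        · exact ht.1
        · linarith [ht.2]
        · linarith
    _ = _ := by ring

lemma hasSum_integral_termIntegrand :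
    HasSum (fun k => ∫ x in (0 : ℝ)..1, termIntegrand k x)
      (∫ x in (0 : ℝ)..1, seriesIntegrand x) := by
  have hsum := (hasSum_quadratic_mul_geometric
    (show ‖(1 / 2 : ℝ)‖ < 1 by rw [Real.norm_of_nonneg] <;> norm_num)).summable
  refine intervalIntegral.hasSum_integral_of_dominated_convergence
    (fun k x => (25 * (k + 1 : ℝ) - 3) * (k + 1) * (1 / 2) ^ k * (|logWeight x| + 7))
    (fun k => ?_) (fun k => .of_forall fun x hx => ?_) (.of_forall fun x hx => ?_) ?_
    (.of_forall fun x hx => ?_)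
  · have : Measurable (termIntegrand k) := by
      unfold termIntegrand logWeight
      fun_prop
    exact this.aestronglyMeasurable
  · exact norm_termIntegrand_le k (by rwa [Set.uIoc_of_le zero_le_one] at hx)
  · exact hsum.mul_right _
  · simp only [tsum_mul_right]
    exact (intervalIntegrable_logWeight.abs.add intervalIntegrable_const).const_mul _
  · exact hasSum_termIntegrand (by rwa [Set.uIoc_of_le zero_le_one] at hx)

/-- An antiderivative of `seriesIntegrand x - 2 * (logWeight x / (1 + x ^ 2))`. -/
noncomputable def seriesPrimitive (x : ℝ) : ℝ :=
  7 * (x * Real.log x) * ((36 - 33 * x + 6 * x ^ 2 + 10 * x ^ 3 - 10 * x ^ 4 + 3 * x ^ 5) /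
      ((2 - x) * (1 + x ^ 2)) ^ 2) -
    8 * ((1 - x) * Real.log (1 - x)) * ((-12 + 36 * x - 24 * x ^ 2 + 6 * x ^ 3 - 2 * x ^ 4) /
      ((2 - x) * (1 + x ^ 2)) ^ 2) +
    (132 + 22 * x - 22 * x ^ 2) / ((2 - x) * (1 + x ^ 2)) +
    12 * Real.log (2 - x) - 6 * Real.log (1 + x ^ 2)

lemma continuousOn_seriesPrimitive : ContinuousOn seriesPrimitive (Set.Icc 0 1) := by
  have h1 : ∀ x ∈ Set.Icc (0 : ℝ) 1, 2 - x ≠ 0 := fun x hx => by linarith [hx.2]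
  have h2 : ∀ x ∈ Set.Icc (0 : ℝ) 1, 1 + x ^ 2 ≠ 0 := fun x _ => by positivity
  have h3 : ∀ x ∈ Set.Icc (0 : ℝ) 1, (2 - x) * (1 + x ^ 2) ≠ 0 := fun x hx =>
    mul_ne_zero (h1 x hx) (h2 x hx)
  have h4 : ∀ x ∈ Set.Icc (0 : ℝ) 1, ((2 - x) * (1 + x ^ 2)) ^ 2 ≠ 0 := fun x hx =>
    pow_ne_zero 2 (h3 x hx)
  have h5 := Real.continuous_mul_log
  have h6 : Continuous fun x : ℝ => (1 - x) * Real.log (1 - x) :=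
    h5.comp (continuous_const.sub continuous_id)
  refine (((((h5.const_mul 7).continuousOn.mul ?_).sub
    ((h6.const_mul 8).continuousOn.mul ?_)).add ?_).add ?_).sub ?_
  all_goals fun_prop (disch := assumption)

lemma hasDerivAt_seriesPrimitive {x : ℝ} (hx : x ∈ Set.Ioo (0 : ℝ) 1) :
    HasDerivAt seriesPrimitive (seriesIntegrand x - 2 * (logWeight x / (1 + x ^ 2))) x := by
  have n1 : 2 - x ≠ 0 := by linarith [hx.2]
  have n2 : 1 + x ^ 2 ≠ 0 := by positivity
  have n3 : 1 - x ≠ 0 := by linarith [hx.2]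
  have hid := hasDerivAt_id' x
  have hlog := Real.hasDerivAt_mul_log hx.1.ne'
  have hlog' := (Real.hasDerivAt_mul_log n3).comp x (hid.const_sub 1)
  have hsq := (hasDerivAt_pow 2 x).const_add 1
  have hd := (hid.const_sub 2).mul hsq
  have hP := (((((hid.const_mul 33).const_sub 36).add ((hasDerivAt_pow 2 x).const_mul 6)).add
    ((hasDerivAt_pow 3 x).const_mul 10)).sub ((hasDerivAt_pow 4 x).const_mul 10)).add
    ((hasDerivAt_pow 5 x).const_mul 3)
  have hQ := ((((hid.const_mul 36).const_add (-12)).sub ((hasDerivAt_pow 2 x).const_mul 24)).add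
    ((hasDerivAt_pow 3 x).const_mul 6)).sub ((hasDerivAt_pow 4 x).const_mul 2)
  have hA := ((hid.const_mul 22).const_add 132).sub ((hasDerivAt_pow 2 x).const_mul 22)
  have hn := mul_ne_zero n1 n2
  have key := ((((hlog.const_mul 7).mul (hP.div (hd.pow 2) (pow_ne_zero 2 hn))).sub
    ((hlog'.const_mul 8).mul (hQ.div (hd.pow 2) (pow_ne_zero 2 hn)))).add
    (hA.div hd hn)).add (((hid.const_sub 2).log n1).const_mul 12) |>.sub
    ((hsq.log n2).const_mul 6)
  refine key.congr_deriv ?_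
  simp only [seriesIntegrand, logWeight, Pi.mul_apply, Pi.add_apply, Pi.sub_apply, Pi.pow_apply,
    Pi.div_apply, Function.comp_apply]
  generalize Real.log x = u
  generalize Real.log (1 - x) = v
  field_simp
  ring

lemma intervalIntegrable_seriesIntegrand :
    IntervalIntegrable seriesIntegrand MeasureTheory.volume 0 1 := by
  have h3 : ∀ x ∈ Set.uIcc (0 : ℝ) 1, (2 - x) * (1 + x ^ 2) ≠ 0 := fun x hx => by
    rw [Set.uIcc_of_le zero_le_one] at hx
    exact mul_ne_zero (by linarith [hx.2]) (by positivity)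
  have h4 (n : ℕ) : ∀ x ∈ Set.uIcc (0 : ℝ) 1, ((2 - x) * (1 + x ^ 2)) ^ n ≠ 0 := fun x hx =>
    pow_ne_zero n (h3 x hx)
  have h2 := h4 2
  have h5 := h4 3
  refine (intervalIntegrable_logWeight.continuousOn_mul ?_).add
    (ContinuousOn.intervalIntegrable ?_)
  · fun_prop (disch := assumption)
  · fun_prop (disch := assumption)

lemma integral_seriesIntegrand :
    ∫ x in (0 : ℝ)..1, seriesIntegrand x =
      2 * catalanG - 2 * (Real.pi + 9) * Real.log 2 := by
  have hw := (intervalIntegrable_div_one_add_sq intervalIntegrable_logWeight).const_mul 2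
  have h := intervalIntegral.integral_eq_sub_of_hasDerivAt_of_le zero_le_one
    continuousOn_seriesPrimitive (fun x hx => hasDerivAt_seriesPrimitive hx)
    (intervalIntegrable_seriesIntegrand.sub hw)
  have e : (fun x => logWeight x / (1 + x ^ 2)) = fun x => 7 * (Real.log x / (1 + x ^ 2)) -
      8 * (Real.log (1 - x) / (1 + x ^ 2)) := by
    ext x
    rw [logWeight]
    ring
  have hL : ∫ x in (0 : ℝ)..1, logWeight x / (1 + x ^ 2) = catalanG - Real.pi * Real.log 2 := by
    rw [e, intervalIntegral.integral_sub
      ((intervalIntegrable_div_one_add_sq intervalIntegral.intervalIntegrable_log').const_mul 7)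
      ((intervalIntegrable_div_one_add_sq intervalIntegrable_log_one_sub).const_mul 8),
      intervalIntegral.integral_const_mul, intervalIntegral.integral_const_mul,
      integral_log_div_one_add_sq, integral_log_one_sub_div_one_add_sq]
    ring
  have hb : seriesPrimitive 1 - seriesPrimitive 0 = -18 * Real.log 2 := by
    norm_num [seriesPrimitive]
    ring
  rw [intervalIntegral.integral_sub intervalIntegrable_seriesIntegrand hw,
    intervalIntegral.integral_const_mul, hL, hb] at h
  linarith

theorem sun_inv3k_25k3 :
    ∑' k : ℕ, (harmonicNum (3 * (k + 1)) - 8 * harmonicNum (2 * (k + 1)) +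
          7 * harmonicNum (k + 1)) * (25 * (k + 1 : ℝ) - 3) /
        (2 ^ (k + 1) * (Nat.choose (3 * (k + 1)) (k + 1) : ℝ)) =
      2 * catalanG - 2 * (Real.pi + 9) * Real.log 2 := by
  simp only [← integral_termIntegrand]
  rw [hasSum_integral_termIntegrand.tsum_eq, integral_seriesIntegrand]
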